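/- Let K be a field of characteristic zero, let N_1, …, N_n be integers each at least 2, and let 0 ≤ t ≤ n. Define g : K^n → K^n by g(x_1, …, x_n) = (C_{N_1}(x_1), …, C_{N_t}(x_t), x_{t+1}^{N_{t+1}}, …, x_n^{N_n}), where C_N is the degree-N Chebyshev polynomial. Then there exists a point b ∈ K^n whose forward orbit {g^{∘m}(b) : m ∈ ℕ} is Zariski dense in affine n-space, i.e. the only polynomial G ∈ K[x_1, …, x_n] with G(g^{∘m}(b)) = 0 for every m ∈ ℕ is the zero polynomial. -/

import Mathlib

open Filter Asymptotics in
/-- In a finite family of functions that is totally ordered by `=o`, one member dominates. -/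
theorem exists_dominant_of_isLittleO_total {α : Type*} (f : α → ℕ → ℝ) (S : Finset α)
    (hS : S.Nonempty)
    (h : ∀ a ∈ S, ∀ b ∈ S, a ≠ b → f a =o[atTop] f b ∨ f b =o[atTop] f a) :
    ∃ a ∈ S, ∀ b ∈ S, b ≠ a → f b =o[atTop] f a := by
  classical
  induction hS using Finset.Nonempty.cons_induction with
  | singleton a => exact ⟨a, by simp, by simp⟩
  | cons a s ha hs ih =>
    obtain ⟨c, hc, hcmax⟩ := ih fun x hx y hy =>
      h x (Finset.mem_cons_of_mem hx) y (Finset.mem_cons_of_mem hy)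
    have hne : a ≠ c := fun e => ha (e ▸ hc)
    rcases h a (Finset.mem_cons_self a s) c (Finset.mem_cons_of_mem hc) hne with hac | hca
    · refine ⟨c, Finset.mem_cons_of_mem hc, fun b hb hbc => ?_⟩
      rcases Finset.mem_cons.1 hb with rfl | hb
      · exact hac
      · exact hcmax b hb hbc
    · refine ⟨a, Finset.mem_cons_self a s, fun b hb hba => ?_⟩
      rcases Finset.mem_cons.1 hb with rfl | hb
      · exact absurd rfl hba
      · by_cases hbc : b = c
        · exact hbc ▸ hca
        · exact (hcmax b hb hbc).trans hca

open Filter Asymptotics in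
/-- Eventually nonvanishing functions that are totally ordered by `=o` are linearly independent. -/
theorem eq_zero_of_sum_eq_zero_of_isLittleO_total {α : Type*} (f : α → ℕ → ℝ)
    (hf : ∀ a m, f a m ≠ 0)
    (h : ∀ a b, a ≠ b → f a =o[atTop] f b ∨ f b =o[atTop] f a)
    (S : Finset α) (c : α → ℝ) (hc : ∀ m, ∑ a ∈ S, c a * f a m = 0) :
    ∀ a ∈ S, c a = 0 := by
  classical
  by_contra! hne
  obtain ⟨a₀, ha₀, hca₀⟩ := hne
  obtain ⟨a, ha, hdom⟩ := exists_dominant_of_isLittleO_total f (S.filter fun a => c a ≠ 0)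
    ⟨a₀, by simp [ha₀, hca₀]⟩ fun a _ b _ => h a b
  have hca : c a ≠ 0 := (Finset.mem_filter.1 ha).2
  have hsum : (fun m => ∑ b ∈ (S.filter fun a => c a ≠ 0).erase a, c b * f b m)
      =o[atTop] f a := IsLittleO.fun_sum fun b hb =>
    (hdom b (Finset.mem_of_mem_erase hb) (Finset.ne_of_mem_erase hb)).const_mul_left _
  have heq : (fun m => ∑ b ∈ (S.filter fun a => c a ≠ 0).erase a, c b * f b m)
      = fun m => (-c a) * f a m := by
    funext m
    have h1 := Finset.add_sum_erase _ (fun b => c b * f b m) ha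
    have h2 : ∑ b ∈ S.filter (fun a => c a ≠ 0), c b * f b m = 0 := by
      rw [Finset.sum_filter_of_ne fun b _ hb => left_ne_zero_of_mul hb, hc m]
    linarith
  rw [heq, isLittleO_const_mul_left_iff (neg_ne_zero.2 hca)] at hsum
  exact isLittleO_irrefl (Frequently.of_forall (hf a)) hsum

/-- Logarithms of distinct primes are linearly independent over the integers. -/
theorem eq_of_sum_mul_log_prime_eq {ι : Type*} (p : ι → ℕ) (hp : ∀ i, (p i).Prime)
    (hinj : Function.Injective p) (s : Finset ι) (a b : ι → ℕ)
    (h : ∑ i ∈ s, (a i : ℝ) * Real.log (p i) = ∑ i ∈ s, (b i : ℝ) * Real.log (p i)) :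
    ∀ i ∈ s, a i = b i := by
  classical
  have hlog (e : ι → ℕ) : ∑ i ∈ s, (e i : ℝ) * Real.log (p i)
      = Real.log ((∏ i ∈ s, p i ^ e i : ℕ) : ℝ) := by
    push_cast
    rw [Real.log_prod fun i _ => pow_ne_zero _ (Nat.cast_ne_zero.2 (hp i).ne_zero)]
    simp only [Real.log_pow]
  have hpos (e : ι → ℕ) : 0 < ∏ i ∈ s, p i ^ e i :=
    Finset.prod_pos fun i _ => pow_pos (hp i).pos _
  have hfac (e : ι → ℕ) (i : ι) (hi : i ∈ s) :
      (∏ j ∈ s, p j ^ e j).factorization (p i) = e i := by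
    rw [Nat.factorization_prod fun j _ => pow_ne_zero _ (hp j).ne_zero, Finset.sum_apply']
    rw [Finset.sum_eq_single i]
    · simp [Nat.Prime.factorization_pow (hp i)]
    · intro j _ hj
      simp [Nat.Prime.factorization_pow (hp j), hinj.ne hj]
    · exact fun hn => absurd hi hn
  rw [hlog, hlog] at h
  have h' := Real.log_injOn_pos (Set.mem_Ioi.2 (Nat.cast_pos.2 (hpos a)))
    (Set.mem_Ioi.2 (Nat.cast_pos.2 (hpos b))) h
  intro i hi
  rw [← hfac a i hi, ← hfac b i hi, Nat.cast_injective h']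

open Filter in
/-- A nontrivial combination of exponentials with bases at least `2` tends to `±∞`. -/
theorem tendsto_sum_mul_pow_atTop_or_atBot {ι : Type*} [Fintype ι] (e : ι → ℝ) (N : ι → ℕ)
    (hN : ∀ i, 2 ≤ N i) (h : ∃ i, ∑ j with N j = N i, e j ≠ 0) :
    Tendsto (fun m : ℕ => ∑ i, e i * (N i : ℝ) ^ m) atTop atTop ∨
      Tendsto (fun m : ℕ => ∑ i, e i * (N i : ℝ) ^ m) atTop atBot := by
  classical
  set A : ℕ → ℝ := fun k => ∑ j with N j = k, e j with hA
  set T : Finset ℕ := (Finset.univ.image N).filter fun k => A k ≠ 0 with hT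
  obtain ⟨i, hi⟩ := h
  have hTne : T.Nonempty := ⟨N i, by simp [hT, hA, hi]⟩
  obtain ⟨M, hM, hmax⟩ := T.exists_max_image id hTne
  have hAM : A M ≠ 0 := (Finset.mem_filter.1 hM).2
  have hM2 : 2 ≤ M := by
    obtain ⟨j, _, rfl⟩ := Finset.mem_image.1 (Finset.mem_filter.1 hM).1
    exact hN j
  have hM0 : (0 : ℝ) < M := by positivity
  have hM1 : (1 : ℝ) < M := by exact_mod_cast hM2
  have hsum (m : ℕ) : ∑ i, e i * (N i : ℝ) ^ m
      = (M : ℝ) ^ m * ∑ k ∈ T, A k * ((k : ℝ) / M) ^ m := by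
    have h1 : ∑ i, e i * (N i : ℝ) ^ m = ∑ k ∈ Finset.univ.image N, A k * (k : ℝ) ^ m := by
      rw [← Finset.sum_fiberwise_of_maps_to (g := N) (t := Finset.univ.image N)
        (fun i hi => Finset.mem_image_of_mem N hi)]
      refine Finset.sum_congr rfl fun k _ => ?_
      rw [hA, Finset.sum_mul]
      refine Finset.sum_congr rfl fun j hj => ?_
      rw [(Finset.mem_filter.1 hj).2]
    have h2 : ∑ k ∈ T, A k * (k : ℝ) ^ m = ∑ k ∈ Finset.univ.image N, A k * (k : ℝ) ^ m :=
      Finset.sum_filter_of_ne fun k _ hk => left_ne_zero_of_mul hk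
    rw [h1, ← h2, Finset.mul_sum]
    refine Finset.sum_congr rfl fun k _ => ?_
    rw [div_pow]
    field_simp
  have hlim : Tendsto (fun m : ℕ => ∑ k ∈ T, A k * ((k : ℝ) / M) ^ m) atTop (nhds (A M)) := by
    have h0 : A M = ∑ k ∈ T, if k = M then A k else 0 := by simp [hM]
    rw [h0]
    refine tendsto_finsetSum _ fun k hk => ?_
    by_cases hkM : k = M
    · simp [hkM, div_self hM0.ne']
    · have hlt : (k : ℝ) < M := by exact_mod_cast lt_of_le_of_ne (hmax k hk) hkM
      have := (tendsto_pow_atTop_nhds_zero_of_lt_one (r := (k : ℝ) / M) (by positivity)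
        ((div_lt_one hM0).2 hlt)).const_mul (A k)
      simpa [hkM] using this
  have hpow : Tendsto (fun m : ℕ => (M : ℝ) ^ m) atTop atTop := tendsto_pow_atTop_atTop_of_one_lt hM1
  simp only [hsum]
  rcases lt_or_gt_of_ne hAM with hneg | hpos
  · exact Or.inr (hpow.atTop_mul_neg hneg hlim)
  · exact Or.inl (hpow.atTop_mul_pos hpos hlim)

open Filter Asymptotics in
/-- Two distinct monomials evaluated at `(p i ^ N i ^ m)ᵢ`, with `p i` distinct primes,
have different orders of growth as `m` tends to infinity. -/
theorem isLittleO_prod_prime_pow_total {ι : Type*} [Fintype ι] (p : ι → ℕ)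
    (hp : ∀ i, (p i).Prime) (hinj : Function.Injective p) (N : ι → ℕ) (hN : ∀ i, 2 ≤ N i)
    (a b : ι → ℕ) (hab : a ≠ b) :
    (fun m : ℕ => ∏ i, ((p i : ℝ) ^ N i ^ m) ^ a i)
        =o[atTop] (fun m : ℕ => ∏ i, ((p i : ℝ) ^ N i ^ m) ^ b i) ∨
      (fun m : ℕ => ∏ i, ((p i : ℝ) ^ N i ^ m) ^ b i)
        =o[atTop] (fun m : ℕ => ∏ i, ((p i : ℝ) ^ N i ^ m) ^ a i) := by
  have hexp (c : ι → ℕ) : (fun m : ℕ => ∏ i, ((p i : ℝ) ^ N i ^ m) ^ c i)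
      = fun m : ℕ => Real.exp (∑ i, (c i : ℝ) * Real.log (p i) * (N i : ℝ) ^ m) := by
    funext m
    rw [Real.exp_sum]
    refine Finset.prod_congr rfl fun i _ => ?_
    have hpi : (0 : ℝ) < p i := Nat.cast_pos.2 (hp i).pos
    rw [← pow_mul, ← Real.exp_log (pow_pos hpi _), Real.log_pow]
    push_cast
    ring_nf
  obtain ⟨i, hi⟩ := Function.ne_iff.1 hab
  have key := tendsto_sum_mul_pow_atTop_or_atBot
    (fun i => ((b i : ℝ) - a i) * Real.log (p i)) N hN ⟨i, fun h0 => by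
      refine hi (eq_of_sum_mul_log_prime_eq p hp hinj {j | N j = N i} a b ?_ i (by simp))
      simp only [sub_mul, Finset.sum_sub_distrib] at h0
      linarith⟩
  simp only [hexp, Real.isLittleO_exp_comp_exp_comp, ← Finset.sum_sub_distrib, ← sub_mul]
  refine key.imp_right fun h => ?_
  refine (tendsto_neg_atBot_atTop.comp h).congr fun m => ?_
  simp only [Function.comp, ← Finset.sum_neg_distrib]
  refine Finset.sum_congr rfl fun i _ => ?_
  ring

/-- Iterating a Chebyshev-type polynomial on `x + x⁻¹`. -/
theorem iterate_eval_add_inv {K : Type*} [Field K] (f : K → K) (N : ℕ)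
    (hf : ∀ x : K, x ≠ 0 → f (x + x⁻¹) = x ^ N + x⁻¹ ^ N) (x : K) (hx : x ≠ 0) (m : ℕ) :
    f^[m] (x + x⁻¹) = x ^ N ^ m + x⁻¹ ^ N ^ m := by
  induction m with
  | zero => simp
  | succ m ih =>
    rw [Function.iterate_succ_apply', ih, inv_pow, hf _ (pow_ne_zero _ hx), ← inv_pow,
      ← pow_mul, ← pow_mul, pow_succ]

/-- If a polynomial over a field of characteristic zero vanishes on a set of rational points
on which distinct monomials are `ℚ`-linearly independent, then it is zero. -/
theorem MvPolynomial.eq_zero_of_eval_ratCast_eq_zero {K σ : Type*} [Field K] [CharZero K]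
    [Fintype σ] (q : ℕ → σ → ℚ)
    (hq : ∀ (S : Finset (σ →₀ ℕ)) (c : (σ →₀ ℕ) → ℚ),
      (∀ m, ∑ a ∈ S, c a * ∏ i, q m i ^ a i = 0) → ∀ a ∈ S, c a = 0)
    (G : MvPolynomial σ K) (hG : ∀ m, MvPolynomial.eval (fun i => (q m i : K)) G = 0) :
    G = 0 := by
  by_contra hne
  obtain ⟨a, ha⟩ := Finset.nonempty_iff_ne_empty.2 fun h => hne (MvPolynomial.support_eq_empty.1 h)
  have hca : G.coeff a ≠ 0 := MvPolynomial.mem_support_iff.1 ha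
  refine hca ((Module.forall_dual_apply_eq_zero_iff ℚ (G.coeff a)).1 fun φ => ?_)
  refine hq G.support (fun a => φ (G.coeff a)) (fun m => ?_) a ha
  have h := congrArg φ (hG m)
  rw [MvPolynomial.eval_eq', map_sum, map_zero] at h
  rw [← h]
  refine Finset.sum_congr rfl fun b _ => ?_
  have : G.coeff b * ∏ i, (q m i : K) ^ b i = (∏ i, q m i ^ b i) • G.coeff b := by
    rw [Rat.smul_def]
    push_cast
    ring
  rw [this, map_smul, smul_eq_mul, mul_comm]


/-- **Dense orbits for mixed Chebyshev/power maps.**  Over a field `K` of characteristic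
zero, let `N₁, …, N_n ≥ 2`, let `0 ≤ t ≤ n`, and for `i ≤ t` let `C i` be the degree
`N i` Chebyshev polynomial over `K` (characterized by
`C_N(x + 1/x) = x^N + 1/x^N` for `x ≠ 0`).  Then the map acting by `C_{N_i}` on the
first `t` coordinates and by `x ↦ x^{N_i}` on the rest has a point with Zariski dense
forward orbit. -/
theorem chebyshev_power_dense_orbit (K : Type*) [Field K] [CharZero K]
    (n t : ℕ) (ht : t ≤ n) (N : Fin n → ℕ) (hN : ∀ i, 2 ≤ N i)
    (C : Fin n → Polynomial K)
    (hC : ∀ i : Fin n, (i : ℕ) < t →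
      ∀ x : K, x ≠ 0 → (C i).eval (x + x⁻¹) = x ^ N i + x⁻¹ ^ N i) :
    ∃ b : Fin n → K,
      ∀ G : MvPolynomial (Fin n) K,
        (∀ m : ℕ, MvPolynomial.eval
            (fun i : Fin n => (fun x : K => if (i : ℕ) < t then (C i).eval x else x ^ N i)^[m] (b i))
            G = 0) → G = 0 := by
  open Filter Asymptotics in
  classical
  set p : Fin n → ℕ := fun i => Nat.nth Nat.Prime i with hpdef
  have hp (i : Fin n) : (p i).Prime := Nat.prime_nth_prime i
  have hinj : Function.Injective p := fun i j h =>
    Fin.ext (Nat.nth_injective Nat.infinite_setOfPred_prime h)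
  set q : ℕ → Fin n → ℚ := fun m i =>
    if (i : ℕ) < t then (p i : ℚ) ^ N i ^ m + (p i : ℚ)⁻¹ ^ N i ^ m
    else (p i : ℚ) ^ N i ^ m with hq
  have hone (i : Fin n) (m : ℕ) : (1 : ℝ) ≤ (p i : ℝ) ^ N i ^ m :=
    one_le_pow₀ (by exact_mod_cast (hp i).one_le)
  have hinv (i : Fin n) (m : ℕ) : ((p i : ℝ)⁻¹) ^ N i ^ m ≤ 1 :=
    pow_le_one₀ (by positivity) (inv_le_one_of_one_le₀ (by exact_mod_cast (hp i).one_le))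
  have hinv0 (i : Fin n) (m : ℕ) : 0 ≤ ((p i : ℝ)⁻¹) ^ N i ^ m := by positivity
  have hlow (i : Fin n) (m : ℕ) : (p i : ℝ) ^ N i ^ m ≤ (q m i : ℝ) := by
    simp only [hq]
    split_ifs <;> push_cast <;> linarith [hinv0 i m]
  have hupp (i : Fin n) (m : ℕ) : (q m i : ℝ) ≤ 2 * (p i : ℝ) ^ N i ^ m := by
    simp only [hq]
    split_ifs <;> push_cast <;> linarith [hinv i m, hone i m]
  have htheta (i : Fin n) :
      (fun m => (q m i : ℝ)) =Θ[atTop] fun m : ℕ => (p i : ℝ) ^ N i ^ m := by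
    refine ⟨IsBigO.of_bound 2 (Eventually.of_forall fun m => ?_),
      IsBigO.of_bound 1 (Eventually.of_forall fun m => ?_)⟩ <;>
    · rw [Real.norm_of_nonneg (by linarith [hone i m, hlow i m]),
        Real.norm_of_nonneg (by linarith [hone i m, hlow i m])]
      linarith [hlow i m, hupp i m]
  have hprod (a : Fin n →₀ ℕ) : (fun m => ∏ i, (q m i : ℝ) ^ a i) =Θ[atTop]
      fun m : ℕ => ∏ i, ((p i : ℝ) ^ N i ^ m) ^ a i :=
    IsTheta.finsetProd fun i _ => (htheta i).pow (a i)
  have htotal (a b : Fin n →₀ ℕ) (hab : a ≠ b) :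
      (fun m => ∏ i, (q m i : ℝ) ^ a i) =o[atTop] (fun m => ∏ i, (q m i : ℝ) ^ b i) ∨
        (fun m => ∏ i, (q m i : ℝ) ^ b i) =o[atTop] (fun m => ∏ i, (q m i : ℝ) ^ a i) := by
    rw [(hprod a).isLittleO_congr_left, (hprod b).isLittleO_congr_right,
      (hprod b).isLittleO_congr_left, (hprod a).isLittleO_congr_right]
    exact isLittleO_prod_prime_pow_total p hp hinj N hN a b (DFunLike.coe_injective.ne hab)
  refine ⟨fun i => if (i : ℕ) < t then (p i : K) + (p i : K)⁻¹ else (p i : K), fun G hG => ?_⟩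
  refine MvPolynomial.eq_zero_of_eval_ratCast_eq_zero q (fun S c hc a ha => ?_) G fun m => ?_
  · have := eq_zero_of_sum_eq_zero_of_isLittleO_total
      (fun (a : Fin n →₀ ℕ) m => ∏ i, (q m i : ℝ) ^ a i)
      (fun a m => Finset.prod_ne_zero_iff.2 fun i _ =>
        pow_ne_zero _ (by linarith [hone i m, hlow i m] : (0 : ℝ) < q m i).ne')
      htotal S (fun a => (c a : ℝ)) (fun m => by exact_mod_cast hc m) a ha
    exact_mod_cast this
  · rw [← hG m]
    congr 2
    funext i
    have hpK : (p i : K) ≠ 0 := Nat.cast_ne_zero.2 (hp i).ne_zero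
    by_cases hi : (i : ℕ) < t
    · simp only [hq, hi, if_true]
      rw [iterate_eval_add_inv _ (N i) (hC i hi) _ hpK]
      push_cast
      rfl
    · simp only [hq, hi, if_false]
      rw [pow_iterate]
      push_cast
      rfl
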